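/- For every τ > 0 and b ≥ 0, with Z a standard normal random variable, E[η_soft(τZ, bτ)²] = 2τ²·T(b); in particular, for γ ∈ [0,1] and α ≥ 0, E[η_soft(τZ, γατ)²] = τ²·[2(1 + γ²α²)Φ(−γα) − 2γα·φ(γα)]. -/

import Mathlib

noncomputable section

/-- Soft-thresholding operator. -/
def softThresh (x b : ℝ) : ℝ :=
  if x > b then x - b else if x < -b then x + b else 0

/-- Standard normal density `φ(z) = exp(−z²/2)/√(2π)`. -/
def gpdf (z : ℝ) : ℝ := Real.exp (-z ^ 2 / 2) / Real.sqrt (2 * Real.pi)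

/-- Standard normal cumulative distribution function `Φ(z) = ∫_{−∞}^z φ(x) dx`. -/
def gcdf (z : ℝ) : ℝ := ∫ x in Set.Iic z, gpdf x

/-- `T(z) = (1 + z²)Φ(−z) − zφ(z)`. -/
def Tfun (z : ℝ) : ℝ := (1 + z ^ 2) * gcdf (-z) - z * gpdf z

open MeasureTheory in
lemma integrable_pow_mul_gpdf (n : ℕ) : Integrable fun x : ℝ => x ^ n * gpdf x := by
  have h := integrable_rpow_mul_exp_neg_mul_sq (b := 1 / 2) (by norm_num) (s := n)
    (by linarith [Nat.cast_nonneg (α := ℝ) n])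
  refine (h.div_const (Real.sqrt (2 * Real.pi))).congr (ae_of_all _ fun x => ?_)
  simp only [gpdf, Real.rpow_natCast]
  rw [show -(1 / 2) * x ^ 2 = -x ^ 2 / 2 by ring]
  ring

lemma hasDerivAt_gpdf (x : ℝ) : HasDerivAt gpdf (-x * gpdf x) x := by
  have h : HasDerivAt (fun z : ℝ => -z ^ 2 / 2) (-x) x :=
    ((hasDerivAt_pow 2 x).neg.div_const 2).congr_deriv (by norm_num; ring)
  refine (h.exp.div_const (Real.sqrt (2 * Real.pi))).congr_deriv ?_
  simp only [gpdf]
  ring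

lemma gpdf_neg (x : ℝ) : gpdf (-x) = gpdf x := by
  simp [gpdf]

lemma gpdf_abs (x : ℝ) : gpdf |x| = gpdf x := by
  simp [gpdf]

lemma gcdf_neg (b : ℝ) : gcdf (-b) = ∫ x in Set.Ioi b, gpdf x := by
  simpa [gcdf, gpdf_neg] using integral_comp_neg_Iic (-b) gpdf

open MeasureTheory in
lemma integral_Ioi_sub_sq_mul_gpdf (b : ℝ) :
    ∫ x in Set.Ioi b, (x - b) ^ 2 * gpdf x = Tfun b := by
  have h0 : Integrable gpdf := by simpa using integrable_pow_mul_gpdf 0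
  have h1 : Integrable fun x : ℝ => x * gpdf x := by simpa using integrable_pow_mul_gpdf 1
  have h2 := integrable_pow_mul_gpdf 2
  have hF : Integrable fun x : ℝ => (2 * b - x) * gpdf x :=
    ((h0.const_mul (2 * b)).sub h1).congr
      (ae_of_all _ fun x => by simp only [Pi.sub_apply]; ring)
  have hF' : Integrable fun x : ℝ => (x ^ 2 - 2 * b * x - 1) * gpdf x :=
    ((h2.sub (h1.const_mul (2 * b))).sub h0).congr
      (ae_of_all _ fun x => by simp only [Pi.sub_apply]; ring)
  have hd : ∀ x : ℝ, HasDerivAt (fun x : ℝ => (2 * b - x) * gpdf x)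
      ((x ^ 2 - 2 * b * x - 1) * gpdf x) x := fun x => by
    refine (((hasDerivAt_id' x).const_sub (2 * b)).mul (hasDerivAt_gpdf x)).congr_deriv ?_
    ring
  have hlim := tendsto_zero_of_hasDerivAt_of_integrableOn_Ioi (a := b) (fun x _ => hd x)
    hF'.integrableOn hF.integrableOn
  have hI := integral_Ioi_of_hasDerivAt_of_tendsto' (a := b) (fun x _ => hd x)
    hF'.integrableOn hlim
  calc ∫ x in Set.Ioi b, (x - b) ^ 2 * gpdf x
      = ∫ x in Set.Ioi b, ((1 + b ^ 2) * gpdf x + (x ^ 2 - 2 * b * x - 1) * gpdf x) := by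
        congr 1 with x
        ring
    _ = Tfun b := by
        rw [integral_add (h0.const_mul _).integrableOn hF'.integrableOn, integral_const_mul, hI,
          Tfun, gcdf_neg]
        ring

lemma softThresh_mul_sq {τ b : ℝ} (hτ : 0 < τ) (hb : 0 ≤ b) (z : ℝ) :
    softThresh (τ * z) (b * τ) ^ 2 =
      τ ^ 2 * (Set.Ioi b).indicator (fun x => (x - b) ^ 2) |z| := by
  have e1 : τ * z > b * τ ↔ b < z := by rw [mul_comm τ, gt_iff_lt, mul_lt_mul_iff_left₀ hτ]
  have e2 : τ * z < -(b * τ) ↔ z < -b := by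
    rw [mul_comm τ, ← neg_mul, mul_lt_mul_iff_left₀ hτ]
  simp only [softThresh, e1, e2, Set.indicator_apply, Set.mem_Ioi, lt_abs, lt_neg]
  by_cases h1 : b < z
  · rw [if_pos h1, if_pos (Or.inl h1), abs_of_pos (hb.trans_lt h1)]
    ring
  · by_cases h2 : z < -b
    · rw [if_neg h1, if_pos h2, if_pos (Or.inr h2), abs_of_neg (by linarith)]
      ring
    · simp [h1, h2]

open MeasureTheory in
lemma integral_softThresh_sq_mul_gpdf {τ b : ℝ} (hτ : 0 < τ) (hb : 0 ≤ b) :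
    ∫ z : ℝ, softThresh (τ * z) (b * τ) ^ 2 * gpdf z = 2 * τ ^ 2 * Tfun b := by
  have h : ∀ z : ℝ, softThresh (τ * z) (b * τ) ^ 2 * gpdf z =
      τ ^ 2 * (Set.Ioi b).indicator (fun x => (x - b) ^ 2 * gpdf x) |z| := fun z => by
    rw [softThresh_mul_sq hτ hb, ← gpdf_abs z, Set.indicator_mul_left, mul_assoc]
  simp_rw [h]
  rw [integral_const_mul, integral_comp_abs
    (f := (Set.Ioi b).indicator fun x => (x - b) ^ 2 * gpdf x),
    setIntegral_indicator measurableSet_Ioi, Set.Ioi_inter_Ioi, max_eq_right hb,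
    integral_Ioi_sub_sq_mul_gpdf]
  ring

/-- `E[η_soft(τZ, bτ)²] = 2τ²T(b)`; in particular for `b = γα`,
`E[η_soft(τZ, γατ)²] = τ²(2(1 + γ²α²)Φ(−γα) − 2γα φ(γα))`. -/
theorem softThresh_second_moment_null (τ : ℝ) (hτ : 0 < τ) :
    (∀ b : ℝ, 0 ≤ b →
      (∫ z : ℝ, (softThresh (τ * z) (b * τ)) ^ 2 * gpdf z) = 2 * τ ^ 2 * Tfun b) ∧
      (∀ γ α : ℝ, 0 ≤ γ → γ ≤ 1 → 0 ≤ α →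
        (∫ z : ℝ, (softThresh (τ * z) (γ * α * τ)) ^ 2 * gpdf z)
          = τ ^ 2 * (2 * (1 + γ ^ 2 * α ^ 2) * gcdf (-(γ * α))
              - 2 * (γ * α) * gpdf (γ * α))) := by
  refine ⟨fun b hb => integral_softThresh_sq_mul_gpdf hτ hb, fun γ α hγ _ hα => ?_⟩
  rw [integral_softThresh_sq_mul_gpdf hτ (mul_nonneg hγ hα), Tfun]
  ring
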